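/- Let X = (X_1,…,X_n) be a random vector supported in [a,b]^n satisfying a 𝔡-LSI(σ²), let d = 2, and let f_𝒯(X) = sup_{t ∈ 𝒯} ‖ Σ_{I ∈ 𝓘_{n,2}} X_I t_I ‖. Set T_1 := 𝔼 sup_{t∈𝒯} sup_{v* ∈ 𝓑*_1} ( Σ_{i=1}^n ( Σ_{j=1}^n X_j v*(t_{ij}) )² )^{1/2} and T_2 := sup_{t∈𝒯} sup_{v*∈𝓑*_1} ‖(v*(t_{ij}))_{i,j}‖_op (operator norm of the matrix with entries v*(t_{ij}) for i ≠ j and zero diagonal). Then for all t ≥ 0, ℙ( f_𝒯(X) − 𝔼 f_𝒯(X) ≥ t ) ≤ 2 exp( −(1/(60(b−a)²σ²)) · min( t²/T_1² , t/T_2 ) ). -/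

import Mathlib

open MeasureTheory Finset Real Filter

noncomputable section

/-- Operator norm of a `k`-tensor indexed by tuples in `[n]^k`. -/
def tOp {n k : ℕ} (A : (Fin k → Fin n) → ℝ) : ℝ :=
  ⨆ v : {v : Fin k → Fin n → ℝ // ∀ j, ∑ i, (v j i) ^ 2 ≤ 1},
    ∑ idx : Fin k → Fin n, (∏ j, v.1 j (idx j)) * A idx

/-- `k`-th order difference `𝔥_{i_1 … i_k} f` (L^∞ taken as sup over the involved coordinates). -/
def hOrd {n : ℕ} {𝒳 : Fin n → Type*} (f : (∀ i, 𝒳 i) → ℝ) (k : ℕ)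
    (idx : Fin k → Fin n) (x : ∀ i, 𝒳 i) : ℝ :=
  ⨆ y : (∀ i, 𝒳 i) × (∀ i, 𝒳 i),
    |∑ S ∈ (Finset.univ : Finset (Fin k)).powerset, (-1 : ℝ) ^ S.card *
      f (fun i => if i ∈ Finset.image idx S then y.2 i
                  else if i ∈ Finset.image idx Finset.univ then y.1 i else x i)|

/-- The `k`-tensor `𝔥^{(k)} f`. -/
def hT {n : ℕ} {𝒳 : Fin n → Type*} (f : (∀ i, 𝒳 i) → ℝ) (k : ℕ)
    (idx : Fin k → Fin n) (x : ∀ i, 𝒳 i) : ℝ :=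
  if Function.Injective idx then hOrd f k idx x else 0

/-- First order difference `𝔥_i f` (sup over both replaced coordinates). -/
def hI {n : ℕ} {𝒳 : Fin n → Type*} (f : (∀ i, 𝒳 i) → ℝ) (i : Fin n) (x : ∀ j, 𝒳 j) : ℝ :=
  ⨆ y : 𝒳 i × 𝒳 i, |f (Function.update x i y.1) - f (Function.update x i y.2)|

/-- `𝔥⁺_i f`. -/
def hPlusI {n : ℕ} {𝒳 : Fin n → Type*} (f : (∀ i, 𝒳 i) → ℝ) (i : Fin n) (x : ∀ j, 𝒳 j) : ℝ :=
  ⨆ y : 𝒳 i, max (f x - f (Function.update x i y)) 0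

/-- `𝔥⁻_i f`. -/
def hMinusI {n : ℕ} {𝒳 : Fin n → Type*} (f : (∀ i, 𝒳 i) → ℝ) (i : Fin n) (x : ∀ j, 𝒳 j) : ℝ :=
  ⨆ y : 𝒳 i, max (f (Function.update x i y) - f x) 0

/-- `L^p(μ)` norm. -/
def lpN {α : Type*} [MeasurableSpace α] (μ : Measure α) (p : ℝ) (g : α → ℝ) : ℝ :=
  (∫ x, |g x| ^ p ∂μ) ^ (1 / p)

/-- Entropy functional `Ent_μ(g)`. -/
def ent {α : Type*} [MeasurableSpace α] (μ : Measure α) (g : α → ℝ) : ℝ :=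
  ∫ x, g x * Real.log (g x) ∂μ - (∫ x, g x ∂μ) * Real.log (∫ x, g x ∂μ)

/-- Variance with respect to a measure. -/
def cVar {β : Type*} [MeasurableSpace β] (ν : Measure β) (g : β → ℝ) : ℝ :=
  ∫ y, (g y - ∫ y', g y' ∂ν) ^ 2 ∂ν

/-- `ν i x` is the conditional distribution of the `i`-th coordinate given the others. -/
def IsCondKernel {n : ℕ} {𝒳 : Fin n → Type*} [∀ i, MeasurableSpace (𝒳 i)]
    (μ : Measure (∀ i, 𝒳 i)) (ν : ∀ i, (∀ j, 𝒳 j) → Measure (𝒳 i)) : Prop :=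
  (∀ i x, IsProbabilityMeasure (ν i x)) ∧
  (∀ i x x', (∀ j, j ≠ i → x j = x' j) → ν i x = ν i x') ∧
  (∀ i (g : (∀ j, 𝒳 j) → ℝ), Measurable g → (∃ M, ∀ x, |g x| ≤ M) →
    ∫ x, ∫ y, g (Function.update x i y) ∂(ν i x) ∂μ = ∫ x, g x ∂μ)

/-- `|𝔡 f|²`. -/
def dSq {n : ℕ} {𝒳 : Fin n → Type*} [∀ i, MeasurableSpace (𝒳 i)]
    (ν : ∀ i, (∀ j, 𝒳 j) → Measure (𝒳 i)) (f : (∀ i, 𝒳 i) → ℝ) (x : ∀ i, 𝒳 i) : ℝ :=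
  ∑ i, cVar (ν i x) (fun y => f (Function.update x i y))

/-- The `𝔡`-logarithmic Sobolev inequality with constant `σ2`. -/
def DLSI {n : ℕ} {𝒳 : Fin n → Type*} [∀ i, MeasurableSpace (𝒳 i)]
    (μ : Measure (∀ i, 𝒳 i)) (ν : ∀ i, (∀ j, 𝒳 j) → Measure (𝒳 i)) (σ2 : ℝ) : Prop :=
  IsCondKernel μ ν ∧
  ∀ f : (∀ i, 𝒳 i) → ℝ, Measurable f → (∃ M, ∀ x, |f x| ≤ M) →
    ent μ (fun x => f x ^ 2) ≤ 2 * σ2 * ∫ x, dSq ν f x ∂μ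

end

noncomputable section

/-- `𝓘_{n,d}`: the `d`-element subsets of `[n]`. -/
def IdxSet (n d : ℕ) := {S : Finset (Fin n) // S.card = d}

instance (n d : ℕ) : Fintype (IdxSet n d) := by unfold IdxSet; infer_instance

/-- `Σ_{I ∈ 𝓘_{n,d}} X_I t_I`. -/
def chaosSum {n d : ℕ} {B : Type*} [NormedAddCommGroup B] [NormedSpace ℝ B]
    (t : IdxSet n d → B) (x : Fin n → ℝ) : B :=
  ∑ S : IdxSet n d, (∏ i ∈ S.1, x i) • t S

/-- `f_𝒯(x) = sup_{t ∈ 𝒯} ‖Σ_{I ∈ 𝓘_{n,d}} x_I t_I‖`. -/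
def fSup {n d : ℕ} {B : Type*} [NormedAddCommGroup B] [NormedSpace ℝ B]
    (𝒯 : Set (IdxSet n d → B)) (x : Fin n → ℝ) : ℝ :=
  ⨆ t : 𝒯, ‖chaosSum t.1 x‖

/-- The coefficient `t_{ij}` (with the convention `t_{ii} = 0`). -/
def tpair {n : ℕ} {B : Type*} [NormedAddCommGroup B] [NormedSpace ℝ B]
    (t : IdxSet n 2 → B) (i j : Fin n) : B :=
  if h : ({i, j} : Finset (Fin n)).card = 2 then t ⟨{i, j}, h⟩ else 0

/-- Operator norm of an `n × n` matrix. -/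
def mOp {n : ℕ} (A : Fin n → Fin n → ℝ) : ℝ :=
  ⨆ vw : {vw : (Fin n → ℝ) × (Fin n → ℝ) // (∑ i, vw.1 i ^ 2 ≤ 1) ∧ (∑ i, vw.2 i ^ 2 ≤ 1)},
    ∑ i, ∑ j, vw.1.1 i * vw.1.2 j * A i j

/-- Bounded measurable real functions. -/
def BddMeas {α : Type*} [MeasurableSpace α] (F : α → ℝ) : Prop :=
  Measurable F ∧ ∃ M, ∀ x, |F x| ≤ M

namespace BddMeas

variable {α : Type*} [MeasurableSpace α] {μ : Measure α} {F G : α → ℝ}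

lemma integrable [IsFiniteMeasure μ] (hF : BddMeas F) : Integrable F μ := by
  obtain ⟨hm, M, hM⟩ := hF
  exact Integrable.of_bound hm.aestronglyMeasurable M (Eventually.of_forall hM)

lemma mul (hF : BddMeas F) (hG : BddMeas G) : BddMeas (fun x => F x * G x) := by
  obtain ⟨hm, M, hM⟩ := hF
  obtain ⟨hm', M', hM'⟩ := hG
  refine ⟨hm.mul hm', M * M', fun x => ?_⟩
  rw [abs_mul]
  exact mul_le_mul (hM x) (hM' x) (abs_nonneg _) ((abs_nonneg _).trans (hM x))

lemma sub (hF : BddMeas F) (hG : BddMeas G) : BddMeas (fun x => F x - G x) := by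
  obtain ⟨hm, M, hM⟩ := hF
  obtain ⟨hm', M', hM'⟩ := hG
  refine ⟨hm.sub hm', M + M', fun x => ?_⟩
  exact (abs_sub _ _).trans (add_le_add (hM x) (hM' x))

lemma const (c : ℝ) : BddMeas (fun _ : α => c) := ⟨measurable_const, |c|, fun _ => le_rfl⟩

lemma add (hF : BddMeas F) (hG : BddMeas G) : BddMeas (fun x => F x + G x) := by
  simpa using hF.sub ((const 0).sub hG)

lemma const_mul (hF : BddMeas F) (c : ℝ) : BddMeas (fun x => c * F x) := (const c).mul hF

lemma exp (hF : BddMeas F) : BddMeas (fun x => Real.exp (F x)) := by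
  obtain ⟨hm, M, hM⟩ := hF
  refine ⟨hm.exp, Real.exp M, fun x => ?_⟩
  rw [Real.abs_exp]
  exact Real.exp_le_exp.2 ((le_abs_self _).trans (hM x))

lemma exp_mul (hF : BddMeas F) (l : ℝ) : BddMeas (fun x => Real.exp (l * F x)) :=
  (hF.const_mul l).exp

end BddMeas

section Entropy

variable {α : Type*} [MeasurableSpace α] {μ : Measure α} {F V : α → ℝ}

lemma integral_sub_add {G H : α → ℝ} (hF : Integrable F μ) (hG : Integrable G μ)
    (hH : Integrable H μ) :
    ∫ x, (F x - G x + H x) ∂μ = ∫ x, F x ∂μ - ∫ x, G x ∂μ + ∫ x, H x ∂μ := by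
  rw [← integral_sub hF hG]
  exact integral_add (hF.sub hG) hH

lemma ent_exp : ent μ (fun x => Real.exp (F x)) =
    ∫ x, F x * Real.exp (F x) ∂μ
      - (∫ x, Real.exp (F x) ∂μ) * Real.log (∫ x, Real.exp (F x) ∂μ) := by
  simp only [ent, Real.log_exp, mul_comm]

variable [IsProbabilityMeasure μ]

lemma integral_exp_pos_of_bddMeas (hF : BddMeas F) : 0 < ∫ x, Real.exp (F x) ∂μ :=
  integral_exp_pos hF.exp.integrable

/-- The entropy duality inequality. -/
lemma integral_mul_exp_le_ent (hF : BddMeas F) (hV : BddMeas V) :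
    ∫ x, V x * Real.exp (F x) ∂μ ≤ ent μ (fun x => Real.exp (F x))
      + (∫ x, Real.exp (F x) ∂μ) * Real.log (∫ x, Real.exp (V x) ∂μ) := by
  have hM := integral_exp_pos_of_bddMeas (μ := μ) hF
  have hN := integral_exp_pos_of_bddMeas (μ := μ) hV
  rw [ent_exp]
  set M := ∫ x, Real.exp (F x) ∂μ with hMdef
  set N := ∫ x, Real.exp (V x) ∂μ with hNdef
  have key : ∀ x, V x * Real.exp (F x) - F x * Real.exp (F x)
      + (Real.log M - Real.log N + 1) * Real.exp (F x) ≤ M / N * Real.exp (V x) := by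
    intro x
    have h1 := Real.add_one_le_exp (V x - F x + (Real.log M - Real.log N))
    have h2 : M / N * Real.exp (V x) =
        Real.exp (F x) * Real.exp (V x - F x + (Real.log M - Real.log N)) := by
      rw [← Real.exp_add]
      have : F x + (V x - F x + (Real.log M - Real.log N)) =
        V x + (Real.log M - Real.log N) := by ring
      rw [this, Real.exp_add, Real.exp_sub, Real.exp_log hM, Real.exp_log hN]
      ring
    rw [h2]
    have := mul_le_mul_of_nonneg_left h1 (Real.exp_pos (F x)).le
    linarith
  have i1 := (hV.mul hF.exp).integrable (μ := μ)
  have i2 := (hF.mul hF.exp).integrable (μ := μ)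
  have i3 := (hF.exp.const_mul (Real.log M - Real.log N + 1)).integrable (μ := μ)
  have i4 := (hV.exp.const_mul (M / N)).integrable (μ := μ)
  have := integral_mono ((i1.sub i2).add i3) i4 key
  simp only [Pi.add_apply, Pi.sub_apply] at this
  rw [integral_sub_add i1 i2 i3, integral_const_mul,
    integral_const_mul, ← hMdef, ← hNdef, div_mul_cancel₀ _ hN.ne'] at this
  linarith

/-- Herbst's argument, with an additional self-bounding term. -/
lemma log_integral_exp_le_of_ent_le (hF : BddMeas F) {A B l₀ : ℝ} (hl₀ : 0 < l₀)
    (h : ∀ l, 0 < l → l ≤ l₀ → ent μ (fun x => Real.exp (l * F x)) ≤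
      l ^ 2 * (A * ∫ x, Real.exp (l * F x) ∂μ + B * ∫ x, F x * Real.exp (l * F x) ∂μ)) :
    Real.log (∫ x, Real.exp (l₀ * F x) ∂μ) ≤
      l₀ * (∫ x, F x ∂μ + A * l₀ + B * Real.log (∫ x, Real.exp (l₀ * F x) ∂μ)) := by
  set M : ℝ → ℝ := fun l => ∫ x, Real.exp (l * F x) ∂μ with hMdef
  set M' : ℝ → ℝ := fun l => ∫ x, F x * Real.exp (l * F x) ∂μ with hM'def
  have hMpos : ∀ l, 0 < M l := fun l => integral_exp_pos_of_bddMeas (hF.const_mul l)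
  have hMd : ∀ l, HasDerivAt M (M' l) l := fun l => by
    have huniv : ProbabilityTheory.integrableExpSet F μ = Set.univ :=
      Set.eq_univ_of_forall fun l => (hF.exp_mul l).integrable
    exact ProbabilityTheory.hasDerivAt_mgf (by rw [huniv]; simp)
  have hHd : ∀ l, HasDerivAt (fun l => Real.log (M l)) (M' l / M l) l :=
    fun l => (hMd l).log (hMpos l).ne'
  have hM0 : M 0 = 1 := by simp [hMdef]
  have hM'0 : M' 0 = ∫ x, F x ∂μ := by simp [hM'def]
  set ψ : ℝ → ℝ := fun l => l⁻¹ * Real.log (M l) - B * Real.log (M l) - A * l with hψ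
  have hψd : ∀ l, 0 < l → HasDerivAt ψ
      (-(l ^ 2)⁻¹ * Real.log (M l) + l⁻¹ * (M' l / M l) - B * (M' l / M l) - A * 1) l := by
    intro l hl
    exact (((hasDerivAt_inv hl.ne').mul (hHd l)).sub ((hHd l).const_mul B)).sub
      ((hasDerivAt_id l).const_mul A)
  have hanti : AntitoneOn ψ (Set.Ioc 0 l₀) := by
    refine antitoneOn_of_deriv_nonpos (convex_Ioc 0 l₀)
      (fun l hl => (hψd l hl.1).continuousAt.continuousWithinAt)
      (fun l hl => ?_) (fun l hl => ?_)
    · rw [interior_Ioc] at hl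
      exact (hψd l hl.1).differentiableAt.differentiableWithinAt
    · rw [interior_Ioc] at hl
      rw [(hψd l hl.1).deriv]
      have h1 := h l hl.1 hl.2.le
      rw [ent_exp] at h1
      have h2 : ∫ x, l * F x * Real.exp (l * F x) ∂μ = l * M' l := by
        rw [hM'def, ← integral_const_mul]
        simp only [mul_assoc]
      rw [h2] at h1
      change l * M' l - M l * Real.log (M l) ≤ l ^ 2 * (A * M l + B * M' l) at h1
      have hp : 0 < l ^ 2 * M l := mul_pos (pow_pos hl.1 2) (hMpos l)
      have e : -(l ^ 2)⁻¹ * Real.log (M l) + l⁻¹ * (M' l / M l) - B * (M' l / M l) - A * 1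
          = (l * M' l - M l * Real.log (M l) - l ^ 2 * (A * M l + B * M' l)) / (l ^ 2 * M l) := by
        have := hl.1.ne'
        have := (hMpos l).ne'
        field_simp
        ring
      rw [e]
      exact div_nonpos_of_nonpos_of_nonneg (by linarith) hp.le
  have hlim : Tendsto ψ (nhdsWithin 0 (Set.Ioi 0)) (nhds (∫ x, F x ∂μ)) := by
    have h1 := (hHd 0).tendsto_slope_zero_right
    simp only [zero_add, hM0, Real.log_one, sub_zero, hM'0, div_one, smul_eq_mul] at h1
    have h2 : Tendsto (fun l => B * Real.log (M l) + A * l) (nhdsWithin 0 (Set.Ioi 0))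
        (nhds 0) := by
      have hc : ContinuousAt (fun l => B * Real.log (M l) + A * l) 0 :=
        ((hHd 0).continuousAt.const_mul B).add (continuousAt_id.const_mul A)
      have := hc.tendsto
      simp only [hM0, Real.log_one, mul_zero, add_zero] at this
      exact this.mono_left nhdsWithin_le_nhds
    have h3 := h1.sub h2
    simp only [sub_zero] at h3
    refine h3.congr fun l => ?_
    simp only [hψ]
    ring
  have hle : ψ l₀ ≤ ∫ x, F x ∂μ := by
    refine ge_of_tendsto hlim ?_
    filter_upwards [Ioc_mem_nhdsGT hl₀] with l hl
    exact hanti hl ⟨hl₀, le_rfl⟩ hl.2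
  have : l₀ * ψ l₀ ≤ l₀ * ∫ x, F x ∂μ := mul_le_mul_of_nonneg_left hle hl₀.le
  have e : l₀ * ψ l₀ = Real.log (M l₀) - l₀ * (B * Real.log (M l₀) + A * l₀) := by
    simp only [hψ]
    field_simp
    ring
  change Real.log (M l₀) ≤ l₀ * (∫ x, F x ∂μ + A * l₀ + B * Real.log (M l₀))
  linarith

lemma cVar_le_integral_sq (hF : BddMeas F) (hV : BddMeas V) (S : Set α)
    (hS : ∀ᵐ y ∂μ, y ∈ S) (h : ∀ y ∈ S, ∀ z ∈ S, F y - F z ≤ V y) :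
    cVar μ F ≤ ∫ y, V y ^ 2 ∂μ := by
  set m := ∫ y, F y ∂μ with hm
  have iF := hF.integrable (μ := μ)
  have iF2 := (hF.mul hF).integrable (μ := μ)
  have iV2 := (hV.mul hV).integrable (μ := μ)
  set s := ∫ y, F y * F y ∂μ with hs
  set P := ∫ y, V y * V y ∂μ with hP
  have hvar : cVar μ F = s - m ^ 2 := by
    have e : ∀ y, (F y - m) ^ 2 = F y * F y - 2 * m * F y + m ^ 2 := fun y => by ring
    simp only [cVar, ← hm, e]
    rw [integral_sub_add iF2 (iF.const_mul _) (integrable_const _), integral_const_mul]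
    simp [← hm, ← hs]
    ring
  have h1 : ∀ᵐ y ∂μ, F y * F y - 2 * m * F y + s ≤ V y * V y + P := by
    filter_upwards [hS] with y hy
    have h2 : ∫ z, (F y * F y - 2 * F y * F z + F z * F z) ∂μ ≤ ∫ z, (V y * V y + V z * V z) ∂μ := by
      refine integral_mono_ae (((integrable_const _).sub (iF.const_mul _)).add iF2)
        ((integrable_const _).add iV2) ?_
      filter_upwards [hS] with z hz
      have a1 := h y hy z hz
      have a2 := h z hz y hy
      rcases le_total (F z) (F y) with hh | hh
      · nlinarith [mul_self_nonneg (V z), mul_self_nonneg (V y)]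
      · nlinarith [mul_self_nonneg (V z), mul_self_nonneg (V y)]
    rw [integral_sub_add (integrable_const _) (iF.const_mul _) iF2,
      integral_add (integrable_const _) iV2] at h2
    simp only [integral_const, probReal_univ, one_smul, ← hs, ← hP] at h2
    rw [integral_const_mul, ← hm] at h2
    linarith
  have h3 := integral_mono_ae ((iF2.sub (iF.const_mul (2 * m))).add (integrable_const s))
    (iV2.add (integrable_const P)) h1
  simp only [Pi.add_apply, Pi.sub_apply] at h3
  rw [integral_sub_add iF2 (iF.const_mul _) (integrable_const _), integral_const_mul,
      integral_add iV2 (integrable_const _)] at h3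
  simp only [integral_const, probReal_univ, one_smul, ← hm, ← hs, ← hP] at h3
  have h4 : ∫ y, V y ^ 2 ∂μ = P := by simp only [hP, sq]
  rw [hvar, h4]
  linarith

end Entropy

section CondKernel

variable {n : ℕ} {𝒳 : Fin n → Type*} [∀ i, MeasurableSpace (𝒳 i)] {μ : Measure (∀ i, 𝒳 i)}
  {ν : ∀ i, (∀ j, 𝒳 j) → Measure (𝒳 i)} {g : (∀ i, 𝒳 i) → ℝ}

lemma BddMeas.comp_update (hg : BddMeas g) (x : ∀ i, 𝒳 i) (i : Fin n) :
    BddMeas (fun y => g (Function.update x i y)) :=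
  ⟨hg.1.comp (measurable_update x), hg.2.imp fun _ h _ => h _⟩

lemma IsCondKernel.integrable [IsProbabilityMeasure μ] (h : IsCondKernel μ ν) (hg : BddMeas g)
    (i : Fin n) : Integrable (fun x => ∫ y, g (Function.update x i y) ∂(ν i x)) μ := by
  obtain ⟨hp, -, hd⟩ := h
  by_contra hni
  have h0 : ∫ x, g x ∂μ = 0 := by
    rw [← hd i g hg.1 hg.2, integral_undef hni]
  have hg1 := hg.add (BddMeas.const 1)
  have e : ∀ x, ∫ y, (g (Function.update x i y) + 1) ∂(ν i x)
      = ∫ y, g (Function.update x i y) ∂(ν i x) + 1 := by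
    intro x
    have := hp i x
    rw [integral_add (hg.comp_update x i).integrable (integrable_const _)]
    simp
  have h1 := hd i _ hg1.1 hg1.2
  simp only [e] at h1
  have hni' : ¬ Integrable (fun x => ∫ y, g (Function.update x i y) ∂(ν i x) + 1) μ := by
    intro hi
    refine hni ((hi.sub (integrable_const 1)).congr (Eventually.of_forall fun x => ?_))
    simp
  rw [integral_undef hni', integral_add hg.integrable (integrable_const _), h0] at h1
  simp at h1

lemma IsCondKernel.ae_mem [IsProbabilityMeasure μ] (h : IsCondKernel μ ν) (i : Fin n)
    {S : Set (𝒳 i)} (hS : MeasurableSet S) (hμS : ∀ᵐ x ∂μ, x i ∈ S) :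
    ∀ᵐ x ∂μ, ∀ᵐ y ∂(ν i x), y ∈ S := by
  classical
  set g : (∀ j, 𝒳 j) → ℝ := fun x => Set.indicator Sᶜ (fun _ => (1 : ℝ)) (x i) with hgdef
  have hg : BddMeas g := by
    refine ⟨(measurable_const.indicator hS.compl).comp (measurable_pi_apply i), 1, fun x => ?_⟩
    simp only [hgdef, Set.indicator_apply]
    split_ifs <;> simp
  have h0 : ∫ x, g x ∂μ = 0 := by
    refine integral_eq_zero_of_ae ?_
    filter_upwards [hμS] with x hx
    simp [hgdef, hx]
  have e : ∀ x, ∫ y, g (Function.update x i y) ∂(ν i x) = (ν i x).real Sᶜ := by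
    intro x
    simp only [hgdef, Function.update_self]
    exact integral_indicator_one hS.compl
  have hint := h.integrable hg i
  have h1 := h.2.2 i g hg.1 hg.2
  simp only [e] at h1 hint
  rw [h0, integral_eq_zero_iff_of_nonneg (fun x => measureReal_nonneg) hint] at h1
  filter_upwards [h1] with x hx
  have := h.1 i x
  rw [ae_iff]
  exact (measureReal_eq_zero_iff).1 hx

end CondKernel

section LogSobolev

variable {n : ℕ} {a b : ℝ} {F W : (Fin n → ℝ) → ℝ}

/-- On the cube `[a, b]^n`, the squared length of the one-sided gradient `𝔥⁺ F` is bounded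
by `W`. -/
def GradSqLe (a b : ℝ) (F W : (Fin n → ℝ) → ℝ) : Prop :=
  ∀ x, (∀ i, x i ∈ Set.Icc a b) → ∃ c : Fin n → ℝ, (∀ i, 0 ≤ c i) ∧
    (∀ i, ∀ y ∈ Set.Icc a b, F x - F (Function.update x i y) ≤ c i) ∧ ∑ i, c i ^ 2 ≤ W x

lemma continuous_sSup_sub_update (hF : Continuous F) (i : Fin n) :
    Continuous (fun x => sSup ((fun y => F x - F (Function.update x i y)) '' Set.Icc a b)) := by
  refine isCompact_Icc.continuous_sSup (f := fun x y => F x - F (Function.update x i y)) ?_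
  exact (hF.comp continuous_fst).sub
    (hF.comp (continuous_fst.update i continuous_snd))

lemma bddAbove_sub_update (hF : Continuous F) (x : Fin n → ℝ) (i : Fin n) :
    BddAbove ((fun y => F x - F (Function.update x i y)) '' Set.Icc a b) :=
  (isCompact_Icc.image (continuous_const.sub
    (hF.comp (continuous_const.update i continuous_id)))).bddAbove

lemma gradSqLe_of_forall_pos (hF : Continuous F)
    (h : ∀ x, (∀ i, x i ∈ Set.Icc a b) → ∀ ε > 0, ∃ c : Fin n → ℝ, (∀ i, 0 ≤ c i) ∧
      (∀ i, ∀ y ∈ Set.Icc a b, F x - F (Function.update x i y) ≤ c i + ε) ∧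
      ∑ i, c i ^ 2 ≤ W x) : GradSqLe a b F W := by
  intro x hx
  set d : Fin n → ℝ :=
    fun i => sSup ((fun y => F x - F (Function.update x i y)) '' Set.Icc a b) with hd
  have hdle : ∀ i, ∀ y ∈ Set.Icc a b, F x - F (Function.update x i y) ≤ d i :=
    fun i y hy => le_csSup (bddAbove_sub_update hF x i) ⟨y, hy, rfl⟩
  have hd0 : ∀ i, 0 ≤ d i := fun i => by simpa using hdle i (x i) (hx i)
  refine ⟨d, hd0, hdle, ?_⟩
  have hS : 0 ≤ ∑ i, d i := Finset.sum_nonneg fun i _ => hd0 i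
  refine le_of_forall_pos_le_add fun δ hδ => ?_
  obtain ⟨c, hc0, hc, hcW⟩ := h x hx (δ / (2 * (∑ i, d i + 1))) (by positivity)
  set ε := δ / (2 * (∑ i, d i + 1)) with hε
  have hε0 : 0 < ε := by positivity
  have hdc : ∀ i, d i ≤ c i + ε := fun i => by
    refine csSup_le ⟨_, x i, hx i, rfl⟩ ?_
    rintro _ ⟨y, hy, rfl⟩
    exact hc i y hy
  have h1 : ∀ i, d i ^ 2 ≤ c i ^ 2 + 2 * ε * d i := by
    intro i
    rcases le_total (d i) ε with hh | hh
    · nlinarith [hd0 i, sq_nonneg (c i), mul_nonneg (hd0 i) (sub_nonneg.2 hh),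
        mul_nonneg hε0.le (hd0 i)]
    · have : (d i - ε) ^ 2 ≤ c i ^ 2 :=
        pow_le_pow_left₀ (by linarith) (by linarith [hdc i]) 2
      nlinarith [sq_nonneg ε]
  calc ∑ i, d i ^ 2 ≤ ∑ i, (c i ^ 2 + 2 * ε * d i) := Finset.sum_le_sum fun i _ => h1 i
    _ = ∑ i, c i ^ 2 + 2 * ε * ∑ i, d i := by rw [Finset.sum_add_distrib, Finset.mul_sum]
    _ ≤ W x + δ := by
      refine add_le_add hcW ?_
      have : 2 * ε * (∑ i, d i + 1) = δ := by
        rw [hε]; field_simp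
      nlinarith

lemma GradSqLe.sq {G : ℝ} (hF0 : ∀ x, 0 ≤ F x) (h : GradSqLe a b F fun _ => G) :
    GradSqLe a b (fun x => F x ^ 2) (fun x => 4 * G * F x ^ 2) := by
  intro x hx
  obtain ⟨c, hc0, hc, hcG⟩ := h x hx
  refine ⟨fun i => 2 * F x * c i, fun i => by have := hF0 x; have := hc0 i; positivity,
    fun i y hy => ?_, ?_⟩
  · have h1 := hc i y hy
    have h2 := hF0 (Function.update x i y)
    have h3 := mul_nonneg (hF0 x) (hc0 i)
    rcases le_total (F (Function.update x i y)) (F x) with hh | hh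
    · nlinarith [mul_le_mul_of_nonneg_left h1 (hF0 x), sq_nonneg (F x - F (Function.update x i y))]
    · have := pow_le_pow_left₀ (hF0 x) hh 2
      dsimp only
      linarith
  · have : ∑ i, (2 * F x * c i) ^ 2 = 4 * F x ^ 2 * ∑ i, c i ^ 2 := by
      rw [Finset.mul_sum]
      exact Finset.sum_congr rfl fun _ _ => by ring
    rw [this]
    nlinarith [mul_le_mul_of_nonneg_left hcG (sq_nonneg (F x))]

lemma ent_exp_le_of_gradSqLe {μ : Measure (Fin n → ℝ)} [IsProbabilityMeasure μ]
    {ν : ∀ i : Fin n, (Fin n → ℝ) → Measure ℝ} {σ2 : ℝ} (hσ : 0 < σ2) (hLSI : DLSI μ ν σ2)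
    (hsupp : ∀ᵐ x ∂μ, ∀ i, x i ∈ Set.Icc a b)
    (hFc : Continuous F) (hF : BddMeas F) (hW : BddMeas W) (hFW : GradSqLe a b F W)
    {l : ℝ} (hl : 0 ≤ l) :
    ent μ (fun x => Real.exp (l * F x)) ≤
      l ^ 2 * (σ2 / 2 * ∫ x, W x * Real.exp (l * F x) ∂μ) := by
  obtain ⟨hK, hE⟩ := hLSI
  set G : (Fin n → ℝ) → ℝ := fun x => Real.exp (l / 2 * F x) with hG
  have hGb : BddMeas G := hF.exp_mul _
  have hG2 : ∀ x, G x ^ 2 = Real.exp (l * F x) := fun x => by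
    rw [hG, ← Real.exp_nat_mul]
    congr 1
    push_cast
    ring
  set c : Fin n → (Fin n → ℝ) → ℝ := fun i x =>
    max (sSup ((fun y => F x - F (Function.update x i y)) '' Set.Icc a b)) 0 with hc
  have hc0 : ∀ i x, 0 ≤ c i x := fun i x => le_max_right _ _
  have hcle : ∀ i x, ∀ y ∈ Set.Icc a b, F x - F (Function.update x i y) ≤ c i x :=
    fun i x y hy => (le_csSup (bddAbove_sub_update hFc x i) ⟨y, hy, rfl⟩).trans (le_max_left _ _)
  have hcb : ∀ i, BddMeas (c i) := by
    intro i
    refine ⟨((continuous_sSup_sub_update hFc i).max continuous_const).measurable, ?_⟩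
    obtain ⟨M, hM⟩ := hF.2
    refine ⟨2 * M, fun x => ?_⟩
    have hM0 : 0 ≤ M := (abs_nonneg _).trans (hM x)
    rw [abs_of_nonneg (hc0 i x)]
    refine max_le (Real.sSup_le ?_ (by linarith)) (by linarith)
    rintro _ ⟨y, -, rfl⟩
    have h1 := abs_le.1 (hM x)
    have h2 := abs_le.1 (hM (Function.update x i y))
    dsimp only
    linarith
  have hcW : ∀ x, (∀ i, x i ∈ Set.Icc a b) → ∑ i, c i x ^ 2 ≤ W x := by
    intro x hx
    obtain ⟨d, hd0, hd, hdW⟩ := hFW x hx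
    refine le_trans (Finset.sum_le_sum fun i _ => pow_le_pow_left₀ (hc0 i x) ?_ 2) hdW
    refine max_le (csSup_le ⟨_, x i, hx i, rfl⟩ ?_) (hd0 i)
    rintro _ ⟨y, hy, rfl⟩
    exact hd i y hy
  set V : Fin n → (Fin n → ℝ) → ℝ := fun i x => l / 2 * (c i x * G x) with hV
  have hVb : ∀ i, BddMeas (V i) := fun i => ((hcb i).mul hGb).const_mul _
  have hV2b : ∀ i, BddMeas (fun x => V i x ^ 2) := fun i => by
    simpa only [sq] using (hVb i).mul (hVb i)
  have hGV : ∀ i x, ∀ y ∈ Set.Icc a b, G x - G (Function.update x i y) ≤ V i x := by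
    intro i x y hy
    have h1 := hcle i x y hy
    have h2 := Real.add_one_le_exp (l / 2 * F (Function.update x i y) - l / 2 * F x)
    have h3 : G (Function.update x i y) =
        G x * Real.exp (l / 2 * F (Function.update x i y) - l / 2 * F x) := by
      simp only [hG]
      rw [← Real.exp_add]
      congr 1
      ring
    have hGpos : 0 < G x := Real.exp_pos _
    rw [h3]
    simp only [hV]
    have h4 := mul_le_mul_of_nonneg_left h2 hGpos.le
    have h5 := mul_le_mul_of_nonneg_left h1 (mul_nonneg (by linarith : 0 ≤ l / 2) hGpos.le)
    nlinarith
  have hint : ∀ i, Integrable (fun x => ∫ y, V i (Function.update x i y) ^ 2 ∂(ν i x)) μ :=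
    fun i => hK.integrable (hV2b i) i
  have hsup : ∀ᵐ x ∂μ, ∀ i, ∀ᵐ y ∂(ν i x), y ∈ Set.Icc a b :=
    ae_all_iff.2 fun i => hK.ae_mem i measurableSet_Icc (hsupp.mono fun x hx => hx i)
  have hd : ∫ x, dSq ν G x ∂μ ≤
      ∫ x, ∑ i, ∫ y, V i (Function.update x i y) ^ 2 ∂(ν i x) ∂μ := by
    refine integral_mono_of_nonneg (Eventually.of_forall fun x => ?_)
      (integrable_finsetSum _ fun i _ => hint i) ?_
    · exact Finset.sum_nonneg fun i _ => integral_nonneg fun y => sq_nonneg _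
    · filter_upwards [hsup] with x hx
      refine Finset.sum_le_sum fun i _ => ?_
      have := hK.1 i x
      refine cVar_le_integral_sq (hGb.comp_update x i) ((hVb i).comp_update x i)
        (Set.Icc a b) (hx i) fun y _ z hz => ?_
      simpa using hGV i (Function.update x i y) z hz
  have hd2 : ∫ x, ∑ i, ∫ y, V i (Function.update x i y) ^ 2 ∂(ν i x) ∂μ =
      ∫ x, ∑ i, V i x ^ 2 ∂μ := by
    rw [integral_finsetSum _ fun i _ => hint i,
      integral_finsetSum _ fun i _ => (hV2b i).integrable]
    exact Finset.sum_congr rfl fun i _ => hK.2.2 i _ (hV2b i).1 (hV2b i).2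
  have hd3 : ∫ x, ∑ i, V i x ^ 2 ∂μ ≤ ∫ x, l ^ 2 / 4 * (W x * Real.exp (l * F x)) ∂μ := by
    refine integral_mono_ae (integrable_finsetSum _ fun i _ => (hV2b i).integrable)
      ((hW.mul (hF.exp_mul l)).const_mul _).integrable ?_
    filter_upwards [hsupp] with x hx
    have : ∑ i, V i x ^ 2 = l ^ 2 / 4 * (Real.exp (l * F x) * ∑ i, c i x ^ 2) := by
      rw [← hG2, Finset.mul_sum, Finset.mul_sum]
      exact Finset.sum_congr rfl fun _ _ => by simp only [hV]; ring
    rw [this, mul_comm (W x)]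
    have := hcW x hx
    have := Real.exp_pos (l * F x)
    gcongr
  have hEG := hE G hGb.1 hGb.2
  simp only [hG2] at hEG
  rw [integral_const_mul] at hd3
  have := mul_le_mul_of_nonneg_left (hd.trans (hd2.le.trans hd3)) (by linarith : 0 ≤ 2 * σ2)
  linarith

end LogSobolev

section Deviation

variable {n : ℕ} {a b : ℝ} {f g : (Fin n → ℝ) → ℝ}

lemma add_sq_div_four_le {x u : ℝ} (hu : 0 ≤ u) (hxu : 0 ≤ x + u) :
    (x + u) ^ 2 / 4 ≤ u ^ 2 / 2 + Real.exp x - 1 - x := by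
  rcases le_total 0 x with hx | hx
  · have := Real.quadratic_le_exp_of_nonneg hx
    nlinarith [sq_nonneg (x - u)]
  · have := Real.add_one_le_exp x
    nlinarith

lemma exp_half_le_two : Real.exp (1 / 2) ≤ 2 := by
  have h := Real.add_one_le_exp (-(1 / 2) : ℝ)
  have h2 : Real.exp (1 / 2) * Real.exp (-(1 / 2)) = 1 := by
    rw [← Real.exp_add]; simp
  nlinarith [Real.exp_pos (1 / 2 : ℝ)]

/-- A function whose squared one-sided gradient is bounded by a constant `κ` has a second moment
controlled by its mean and by `κ`. -/
lemma integral_sq_le_of_log_integral_exp_le {α : Type*} [MeasurableSpace α] {μ : Measure α}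
    [IsProbabilityMeasure μ] {g : α → ℝ} (hg : BddMeas g) (hg0 : ∀ x, 0 ≤ g x) {κ : ℝ}
    (hκ : 0 < κ) (h : ∀ l, 0 < l →
      Real.log (∫ x, Real.exp (l * g x) ∂μ) ≤ l * (∫ x, g x ∂μ + κ / 2 * l)) :
    ∫ x, g x ^ 2 ∂μ ≤ 2 * (∫ x, g x ∂μ) ^ 2 + 4 * κ := by
  set m := ∫ x, g x ∂μ with hm
  have hm0 : 0 ≤ m := integral_nonneg hg0
  set l := (Real.sqrt κ)⁻¹ with hl
  have hl0 : 0 < l := by positivity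
  have hlκ : l ^ 2 * κ = 1 := by
    rw [hl, inv_pow, Real.sq_sqrt hκ.le, inv_mul_cancel₀ hκ.ne']
  have hexp : ∫ x, Real.exp (l * (g x - m)) ∂μ ≤ 2 := by
    have e : ∀ x, Real.exp (l * (g x - m)) = Real.exp (-(l * m)) * Real.exp (l * g x) :=
      fun x => by rw [← Real.exp_add]; congr 1; ring
    simp only [e]
    rw [integral_const_mul]
    have hpos := integral_exp_pos_of_bddMeas (μ := μ) (hg.const_mul l)
    have h1 := (Real.log_le_iff_le_exp hpos).1 (h l hl0)
    calc Real.exp (-(l * m)) * ∫ x, Real.exp (l * g x) ∂μ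
        ≤ Real.exp (-(l * m)) * Real.exp (l * (m + κ / 2 * l)) := by gcongr
      _ = Real.exp (1 / 2) := by
        rw [← Real.exp_add]
        congr 1
        linear_combination hlκ / 2
      _ ≤ 2 := exp_half_le_two
  have hgm : BddMeas (fun x => g x - m) := hg.sub (BddMeas.const m)
  have i1 := ((hg.mul hg).const_mul (l ^ 2 / 4)).integrable (μ := μ)
  have i2 := (((hgm.exp_mul l).add (BddMeas.const ((l * m) ^ 2 / 2 - 1)))).integrable (μ := μ)
  have i3 := (hgm.const_mul l).integrable (μ := μ)
  have key := integral_mono i1 (i2.sub i3) fun x => by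
    have := add_sq_div_four_le (x := l * (g x - m)) (u := l * m) (by positivity)
      (by have := hg0 x; nlinarith [mul_nonneg hl0.le this])
    simp only [Pi.sub_apply]
    nlinarith
  rw [integral_sub' i2 i3, integral_add (hgm.exp_mul l).integrable (integrable_const _),
    integral_const_mul, integral_const_mul,
    integral_sub hg.integrable (integrable_const _)] at key
  simp only [integral_const, probReal_univ, one_smul, ← hm, sub_self, mul_zero, sub_zero] at key
  have e : ∫ x, g x ^ 2 ∂μ = ∫ x, g x * g x ∂μ := by simp only [sq]
  rw [e]
  have hk : l ^ 2 / 4 * ∫ x, g x * g x ∂μ ≤ l ^ 2 / 2 * m ^ 2 + 1 := by nlinarith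
  have hk2 := mul_le_mul_of_nonneg_left hk (by positivity : 0 ≤ 4 * κ)
  have e1 : 4 * κ * (l ^ 2 / 4 * ∫ x, g x * g x ∂μ) = ∫ x, g x * g x ∂μ := by
    linear_combination (∫ x, g x * g x ∂μ) * hlκ
  have e2 : 4 * κ * (l ^ 2 / 2 * m ^ 2 + 1) = 2 * m ^ 2 + 4 * κ := by
    linear_combination 2 * m ^ 2 * hlκ
  linarith

variable {μ : Measure (Fin n → ℝ)} [IsProbabilityMeasure μ]
  {ν : ∀ i : Fin n, (Fin n → ℝ) → Measure ℝ} {σ2 : ℝ}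

/-- Exponential moments of a function whose one-sided gradient is bounded by `√δ g`, where the
one-sided gradient of `g` is itself bounded by `√δ τ`. -/
lemma log_integral_exp_le_of_gradSqLe (hσ : 0 < σ2) (hLSI : DLSI μ ν σ2)
    (hsupp : ∀ᵐ x ∂μ, ∀ i, x i ∈ Set.Icc a b)
    (hfc : Continuous f) (hf : BddMeas f) (hgc : Continuous g) (hg : BddMeas g)
    (hg0 : ∀ x, 0 ≤ g x) {δ τ : ℝ} (hδ : 0 < δ) (hτ : 0 < τ)
    (hfg : GradSqLe a b f (fun x => δ * g x ^ 2)) (hgτ : GradSqLe a b g (fun _ => δ * τ ^ 2))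
    {l : ℝ} (hl : 0 < l) (hlτ : 4 * (σ2 * δ) * τ * l ≤ 1) :
    Real.log (∫ x, Real.exp (l * f x) ∂μ) ≤
      l * ∫ x, f x ∂μ + 4 * (σ2 * δ) * (∫ x, g x ∂μ) ^ 2 * l ^ 2 + 1 / 2 := by
  set K := σ2 * δ with hK
  have hK0 : 0 < K := mul_pos hσ hδ
  have hg2 : BddMeas (fun x => g x ^ 2) := by simpa only [sq] using hg.mul hg
  have hEV : ∫ x, g x ^ 2 ∂μ ≤ 2 * (∫ x, g x ∂μ) ^ 2 + 4 * (K * τ ^ 2) := by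
    refine integral_sq_le_of_log_integral_exp_le hg hg0 (by positivity) fun r hr => ?_
    have := log_integral_exp_le_of_ent_le (μ := μ) hg (A := K * τ ^ 2 / 2) (B := 0) hr
      fun s hs _ => by
        have := ent_exp_le_of_gradSqLe hσ hLSI hsupp hgc hg (BddMeas.const _) hgτ hs.le
        rw [integral_const_mul] at this
        refine this.trans (le_of_eq ?_)
        rw [hK]
        ring
    linarith
  set EV := ∫ x, g x ^ 2 ∂μ with hEVdef
  set θ := 1 / (4 * (K * τ ^ 2)) with hθ
  have hθ0 : 0 < θ := by positivity
  have hθK : θ * (4 * (K * τ ^ 2)) = 1 := by rw [hθ]; field_simp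
  have hHV : Real.log (∫ x, Real.exp (θ * g x ^ 2) ∂μ) ≤ 2 * θ * EV := by
    have := log_integral_exp_le_of_ent_le (μ := μ) hg2 (A := 0) (B := 2 * (K * τ ^ 2)) hθ0
      fun s hs _ => by
        have := ent_exp_le_of_gradSqLe hσ hLSI hsupp (hgc.pow 2) hg2
          (hg2.const_mul (4 * (δ * τ ^ 2))) (hgτ.sq hg0) hs.le
        simp only [mul_assoc (4 * (δ * τ ^ 2)), Pi.pow_apply] at this
        rw [integral_const_mul] at this
        refine this.trans (le_of_eq ?_)
        rw [hK]
        ring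
    rw [← hEVdef] at this
    nlinarith [congrArg (· * Real.log (∫ x, Real.exp (θ * g x ^ 2) ∂μ)) hθK]
  have hHf := log_integral_exp_le_of_ent_le (μ := μ) hf (A := 2 * K * EV) (B := 0) hl
    fun s hs hsl => by
      have h1 := ent_exp_le_of_gradSqLe hσ hLSI hsupp hfc hf (hg2.const_mul δ) hfg hs.le
      have h2 := integral_mul_exp_le_ent (μ := μ) (hf.const_mul s) (hg2.const_mul θ)
      simp only [mul_assoc δ] at h1
      simp only [mul_assoc θ] at h2
      rw [integral_const_mul] at h1 h2
      set I := ∫ x, g x ^ 2 * Real.exp (s * f x) ∂μ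
      set M := ∫ x, Real.exp (s * f x) ∂μ with hM
      set E := ent μ (fun x => Real.exp (s * f x))
      have hM0 : 0 < M := integral_exp_pos_of_bddMeas (hf.const_mul s)
      have hEV0 : 0 ≤ EV := integral_nonneg fun _ => sq_nonneg _
      have h3 : θ * I ≤ E + M * (2 * θ * EV) :=
        h2.trans (by gcongr)
      have h4 : I ≤ 4 * (K * τ ^ 2) * E + 2 * M * EV := by
        have := mul_le_mul_of_nonneg_left h3 (by positivity : 0 ≤ 4 * (K * τ ^ 2))
        have e1 : 4 * (K * τ ^ 2) * (θ * I) = I := by linear_combination I * hθK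
        have e2 : 4 * (K * τ ^ 2) * (E + M * (2 * θ * EV)) =
          4 * (K * τ ^ 2) * E + 2 * M * EV := by linear_combination 2 * M * EV * hθK
        linarith
      have hE0 : E ≤ s ^ 2 * K / 2 * I := by rw [hK]; linarith
      have hsτ : 4 * K * τ * s ≤ 1 := le_trans (by gcongr) hlτ
      have hsτ2 : (4 * K * τ * s) ^ 2 ≤ 1 := pow_le_one₀ (by positivity) hsτ
      have h5 : E ≤ s ^ 2 * K / 2 * (4 * (K * τ ^ 2) * E + 2 * M * EV) :=
        hE0.trans (by gcongr)
      rw [zero_mul, add_zero]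
      have h6 : 0 ≤ s ^ 2 * K * M * EV := by positivity
      by_cases hEn : 0 ≤ E
      · nlinarith [mul_le_mul_of_nonneg_right hsτ2 hEn]
      · nlinarith
  have h7 : (4 * K * τ * l) ^ 2 ≤ 1 := pow_le_one₀ (by positivity) hlτ
  have h8 := mul_le_mul_of_nonneg_left hEV (by positivity : 0 ≤ 2 * K * l ^ 2)
  nlinarith

/-- Two-level deviation inequality. -/
lemma measureReal_ge_le_of_gradSqLe (hσ : 0 < σ2) (hLSI : DLSI μ ν σ2)
    (hsupp : ∀ᵐ x ∂μ, ∀ i, x i ∈ Set.Icc a b)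
    (hfc : Continuous f) (hf : BddMeas f) (hgc : Continuous g) (hg : BddMeas g)
    (hg0 : ∀ x, 0 ≤ g x) {δ τ : ℝ} (hδ : 0 < δ) (hτ : 0 ≤ τ)
    (hfg : GradSqLe a b f (fun x => δ * g x ^ 2)) (hgτ : GradSqLe a b g (fun _ => δ * τ ^ 2))
    {t : ℝ} (ht : 0 ≤ t) :
    μ.real {x | t ≤ f x - ∫ y, f y ∂μ} ≤
      2 * Real.exp (-(1 / (16 * δ * σ2)) * min (t ^ 2 / (∫ x, g x ∂μ) ^ 2) (t / τ)) := by
  set T := ∫ x, g x ∂μ with hT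
  have hT0 : 0 ≤ T := integral_nonneg hg0
  set m := min (t ^ 2 / T ^ 2) (t / τ) with hm
  have hm0 : 0 ≤ m := le_min (by positivity) (by positivity)
  rcases hm0.eq_or_lt with hm' | hm'
  · rw [← hm', mul_zero, Real.exp_zero]
    exact measureReal_le_one.trans (by norm_num)
  have hτ' : 0 < τ := by
    refine hτ.lt_of_ne fun h => ?_
    have := hm'.trans_le (min_le_right _ _)
    simp [← h] at this
  have hT' : 0 < T := by
    refine hT0.lt_of_ne fun h => ?_
    have := hm'.trans_le (min_le_left _ _)
    simp [← h] at this
  have ht' : 0 < t := by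
    refine ht.lt_of_ne fun h => ?_
    have := hm'.trans_le (min_le_right _ _)
    simp [← h] at this
  have hm1 : m * T ^ 2 ≤ t ^ 2 := (le_div_iff₀ (by positivity)).1 (min_le_left _ _)
  have hm2 : m * τ ≤ t := (le_div_iff₀ hτ').1 (min_le_right _ _)
  set K := σ2 * δ with hK
  have hK0 : 0 < K := mul_pos hσ hδ
  set l := m / (8 * K * t) with hl
  have hl0 : 0 < l := by positivity
  have hlt : l * t = m / (8 * K) := by rw [hl]; field_simp
  have hlog := log_integral_exp_le_of_gradSqLe hσ hLSI hsupp hfc hf hgc hg hg0 hδ hτ' hfg hgτ hl0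
    (by
      rw [← hK, hl, mul_div_assoc', div_le_one (by positivity)]
      nlinarith [mul_le_mul_of_nonneg_left hm2 hK0.le, mul_pos hK0 ht'])
  rw [← hK, ← hT] at hlog
  have hpos := integral_exp_pos_of_bddMeas (μ := μ) (hf.const_mul l)
  have hmgf := (Real.log_le_iff_le_exp hpos).1 hlog
  have hch := ProbabilityTheory.measure_ge_le_exp_mul_mgf (μ := μ) (X := f)
    (t + ∫ y, f y ∂μ) hl0.le (hf.exp_mul l).integrable
  have hset : {x | t ≤ f x - ∫ y, f y ∂μ} = {x | t + ∫ y, f y ∂μ ≤ f x} := by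
    ext x
    exact le_sub_iff_add_le (α := ℝ)
  rw [hset]
  have h1 : 4 * K * T ^ 2 * l ^ 2 ≤ l * t / 2 := by
    have : 8 * K * T ^ 2 * l ≤ t := by
      rw [hl, mul_div_assoc', div_le_iff₀ (by positivity)]
      nlinarith [mul_le_mul_of_nonneg_left hm1 hK0.le]
    nlinarith
  calc μ.real {x | t + ∫ y, f y ∂μ ≤ f x}
      ≤ Real.exp (-l * (t + ∫ y, f y ∂μ)) * ∫ x, Real.exp (l * f x) ∂μ := hch
    _ ≤ Real.exp (-l * (t + ∫ y, f y ∂μ)) *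
        Real.exp (l * ∫ x, f x ∂μ + 4 * K * T ^ 2 * l ^ 2 + 1 / 2) := by gcongr
    _ = Real.exp (1 / 2) * Real.exp (-(l * t) + 4 * K * T ^ 2 * l ^ 2) := by
      rw [← Real.exp_add, ← Real.exp_add]
      congr 1
      ring
    _ ≤ 2 * Real.exp (-(1 / (16 * δ * σ2)) * m) := by
      refine mul_le_mul exp_half_le_two (Real.exp_le_exp.2 ?_) (Real.exp_pos _).le (by norm_num)
      have e : 1 / (16 * δ * σ2) * m = l * t / 2 := by
        rw [hlt, hK]
        field_simp
        norm_num
      linarith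

end Deviation

section IteratedSup

variable {ι κ : Type*} {h : ι → κ → ℝ} {C : ℝ}

lemma le_ciSup_ciSup (hC : ∀ i k, h i k ≤ C) (i : ι) (k : κ) : h i k ≤ ⨆ i, ⨆ k, h i k := by
  have : Nonempty κ := ⟨k⟩
  exact (le_ciSup (f := h i) ⟨C, by rintro _ ⟨k, rfl⟩; exact hC i k⟩ k).trans
    (le_ciSup (f := fun i => ⨆ k, h i k) ⟨C, by rintro _ ⟨i, rfl⟩; exact ciSup_le (hC i)⟩ i)

lemma exists_lt_of_lt_ciSup_ciSup [Nonempty ι] [Nonempty κ] {r : ℝ}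
    (hr : r < ⨆ i, ⨆ k, h i k) : ∃ i k, r < h i k := by
  obtain ⟨i, hi⟩ := exists_lt_of_lt_ciSup hr
  exact ⟨i, exists_lt_of_lt_ciSup hi⟩

end IteratedSup

section Chaos

variable {n : ℕ}

lemma sqrt_sum_sq_eq_norm (z : Fin n → ℝ) :
    Real.sqrt (∑ i, z i ^ 2) = ‖WithLp.toLp 2 z‖ := by
  rw [EuclideanSpace.norm_eq]
  simp

lemma sqrt_sum_sq_le_add (z z' : Fin n → ℝ) :
    Real.sqrt (∑ i, z i ^ 2) ≤ Real.sqrt (∑ i, z' i ^ 2) + Real.sqrt (∑ i, (z i - z' i) ^ 2) := by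
  have := norm_le_norm_add_norm_sub' (WithLp.toLp 2 z) (WithLp.toLp 2 z')
  rw [← WithLp.toLp_sub] at this
  simpa only [← sqrt_sum_sq_eq_norm, Pi.sub_apply] using this

lemma sqrt_sum_sq_le_sum_abs (z : Fin n → ℝ) : Real.sqrt (∑ i, z i ^ 2) ≤ ∑ i, |z i| := by
  refine Real.sqrt_le_iff.2 ⟨Finset.sum_nonneg fun i _ => abs_nonneg _, ?_⟩
  simpa only [sq_abs] using
    Finset.sum_sq_le_sq_sum_of_nonneg (s := Finset.univ) (f := fun i => |z i|)
      fun i _ => abs_nonneg _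

lemma sum_mul_le_sqrt_sum_sq {w : Fin n → ℝ} (hw : ∑ i, w i ^ 2 ≤ 1) (z : Fin n → ℝ) :
    ∑ i, w i * z i ≤ Real.sqrt (∑ i, z i ^ 2) := by
  refine (Real.sum_mul_le_sqrt_mul_sqrt Finset.univ w z).trans ?_
  have : Real.sqrt (∑ i, w i ^ 2) ≤ 1 := by simpa using Real.sqrt_le_sqrt hw
  nlinarith [Real.sqrt_nonneg (∑ i, z i ^ 2)]

lemma exists_sum_mul_eq_sqrt_sum_sq (z : Fin n → ℝ) :
    ∃ w : Fin n → ℝ, ∑ i, w i ^ 2 ≤ 1 ∧ ∑ i, w i * z i = Real.sqrt (∑ i, z i ^ 2) := by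
  set r := Real.sqrt (∑ i, z i ^ 2) with hr
  have hs : r ^ 2 = ∑ i, z i ^ 2 := Real.sq_sqrt (Finset.sum_nonneg fun i _ => sq_nonneg _)
  refine ⟨fun i => z i / r, ?_, ?_⟩
  · simp only [div_pow]
    rw [← Finset.sum_div, ← hs]
    exact div_self_le_one _
  · have : ∀ i, z i / r * z i = z i ^ 2 / r := fun i => by ring
    simp only [this]
    rw [← Finset.sum_div, ← hs, sq, mul_self_div_self]

lemma abs_le_one_of_sum_sq_le_one {w : Fin n → ℝ} (hw : ∑ i, w i ^ 2 ≤ 1) (i : Fin n) :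
    |w i| ≤ 1 := by
  rw [← sq_le_one_iff_abs_le_one]
  exact (Finset.single_le_sum (fun i _ => sq_nonneg (w i)) (Finset.mem_univ i)).trans hw

lemma sum_sum_mul_le {A : Fin n → Fin n → ℝ} {M : ℝ} (hM : ∀ i j, |A i j| ≤ M) {w u : Fin n → ℝ}
    (hw : ∑ i, w i ^ 2 ≤ 1) (hu : ∑ i, u i ^ 2 ≤ 1) :
    ∑ i, ∑ j, w i * u j * A i j ≤ ∑ _i : Fin n, ∑ _j : Fin n, M := by
  refine Finset.sum_le_sum fun i _ => Finset.sum_le_sum fun j _ => (le_abs_self _).trans ?_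
  rw [abs_mul, abs_mul]
  have h1 := abs_le_one_of_sum_sq_le_one hw i
  have h2 := abs_le_one_of_sum_sq_le_one hu j
  have h3 : |w i| * |u j| ≤ 1 := mul_le_one₀ h1 (abs_nonneg _) h2
  calc |w i| * |u j| * |A i j| ≤ 1 * |A i j| := by gcongr
    _ ≤ M := by rw [one_mul]; exact hM i j

lemma mOp_le {A : Fin n → Fin n → ℝ} {M : ℝ} (hM : ∀ i j, |A i j| ≤ M) :
    mOp A ≤ ∑ _i : Fin n, ∑ _j : Fin n, M := by
  have : Nonempty {vw : (Fin n → ℝ) × (Fin n → ℝ) //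
      (∑ i, vw.1 i ^ 2 ≤ 1) ∧ (∑ i, vw.2 i ^ 2 ≤ 1)} := ⟨⟨0, by simp⟩⟩
  exact ciSup_le fun vw => sum_sum_mul_le hM vw.2.1 vw.2.2

lemma le_mOp (A : Fin n → Fin n → ℝ) {w u : Fin n → ℝ}
    (hw : ∑ i, w i ^ 2 ≤ 1) (hu : ∑ i, u i ^ 2 ≤ 1) :
    ∑ i, ∑ j, w i * u j * A i j ≤ mOp A := by
  refine le_ciSup (f := fun vw : {vw : (Fin n → ℝ) × (Fin n → ℝ) //
      (∑ i, vw.1 i ^ 2 ≤ 1) ∧ (∑ i, vw.2 i ^ 2 ≤ 1)} =>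
    ∑ i, ∑ j, vw.1.1 i * vw.1.2 j * A i j) ?_ ⟨(w, u), hw, hu⟩
  refine ⟨∑ _i : Fin n, ∑ _j : Fin n, ∑ i, ∑ j, |A i j|, ?_⟩
  rintro _ ⟨vw, rfl⟩
  refine sum_sum_mul_le (fun i j => ?_) vw.2.1 vw.2.2
  exact (Finset.single_le_sum (f := fun j => |A i j|) (fun j _ => abs_nonneg _)
    (Finset.mem_univ j)).trans (Finset.single_le_sum (f := fun i => ∑ j, |A i j|)
      (fun i _ => Finset.sum_nonneg fun j _ => abs_nonneg _) (Finset.mem_univ i))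

lemma sqrt_sum_sq_mul_le_mOp (A : Fin n → Fin n → ℝ) {w : Fin n → ℝ} (hw : ∑ i, w i ^ 2 ≤ 1) :
    Real.sqrt (∑ j, (∑ i, w i * A i j) ^ 2) ≤ mOp A := by
  obtain ⟨u, hu, hue⟩ := exists_sum_mul_eq_sqrt_sum_sq fun j => ∑ i, w i * A i j
  rw [← hue]
  refine le_trans (le_of_eq ?_) (le_mOp A hw hu)
  rw [Finset.sum_comm]
  refine Finset.sum_congr rfl fun j _ => ?_
  rw [Finset.mul_sum]
  exact Finset.sum_congr rfl fun i _ => by ring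

variable {B : Type*} [NormedAddCommGroup B] [NormedSpace ℝ B]

lemma chaosSum_sub_update (s : IdxSet n 2 → B) (x : Fin n → ℝ) (i : Fin n) (y : ℝ) :
    chaosSum s x - chaosSum s (Function.update x i y) =
      (x i - y) • ∑ j, x j • tpair s i j := by
  classical
  simp only [chaosSum]
  rw [← Finset.sum_sub_distrib, Finset.smul_sum]
  have hl : ∑ S : IdxSet n 2, ((∏ k ∈ S.1, x k) • s S -
        (∏ k ∈ S.1, Function.update x i y k) • s S) =
      ∑ S : IdxSet n 2 with i ∈ S.1, ((∏ k ∈ S.1, x k) • s S -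
        (∏ k ∈ S.1, Function.update x i y k) • s S) := by
    refine (Finset.sum_filter_of_ne fun S _ hS => ?_).symm
    by_contra hi
    refine hS ?_
    rw [Finset.prod_update_of_notMem hi, sub_self]
  have hr : ∑ j, (x i - y) • x j • tpair s i j =
      ∑ j ∈ Finset.univ.erase i, (x i - y) • x j • tpair s i j := by
    rw [Finset.sum_erase]
    simp [tpair]
  rw [hl, hr]
  symm
  refine Finset.sum_bij
    (fun j hj => ⟨{i, j}, Finset.card_pair (Finset.ne_of_mem_erase hj).symm⟩) ?_ ?_ ?_ ?_
  · intro j _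
    exact Finset.mem_filter.2 ⟨Finset.mem_univ _, Finset.mem_insert_self i _⟩
  · intro j hj j' _ h
    have h1 : ({i, j} : Finset (Fin n)) = {i, j'} := congrArg Subtype.val h
    have h2 : j ∈ ({i, j'} : Finset (Fin n)) := by rw [← h1]; simp
    simpa [Finset.ne_of_mem_erase hj] using h2
  · rintro ⟨S, hS⟩ hi
    replace hi : i ∈ S := (Finset.mem_filter.1 hi).2
    obtain ⟨j, hj⟩ := Finset.card_eq_one.1
      (show (S.erase i).card = 1 by rw [Finset.card_erase_of_mem hi, hS])
    have hjS : j ∈ S.erase i := by rw [hj]; simp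
    refine ⟨j, by simpa using Finset.ne_of_mem_erase hjS, Subtype.ext ?_⟩
    change {i, j} = S
    rw [← Finset.insert_erase hi, hj]
  · intro j hj
    have hji := Finset.ne_of_mem_erase hj
    have hc : ({i, j} : Finset (Fin n)).card = 2 := Finset.card_pair hji.symm
    simp only [tpair, hc, dite_true]
    rw [← sub_smul, smul_smul, Finset.prod_pair hji.symm, Finset.prod_pair hji.symm,
      Function.update_self, Function.update_of_ne hji]
    congr 1
    ring

lemma exists_norm_tpair_le {𝒯 : Set (IdxSet n 2 → B)} (h𝒯 : IsCompact 𝒯) :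
    ∃ M, 0 ≤ M ∧ ∀ s ∈ 𝒯, ∀ i j, ‖tpair s i j‖ ≤ M := by
  obtain ⟨M, hM0, hM⟩ := h𝒯.isBounded.exists_pos_norm_le
  refine ⟨M, hM0.le, fun s hs i j => ?_⟩
  unfold tpair
  split_ifs with h
  · exact (norm_le_pi_norm s _).trans (hM s hs)
  · simpa using hM0.le

lemma abs_apply_tpair_le {𝒯 : Set (IdxSet n 2 → B)} {M : ℝ}
    (hM : ∀ s ∈ 𝒯, ∀ i j, ‖tpair s i j‖ ≤ M) (s : 𝒯) (v : {v : B →L[ℝ] ℝ // ‖v‖ ≤ 1})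
    (i j : Fin n) : |v.1 (tpair s.1 i j)| ≤ M :=
  (v.1.le_of_opNorm_le v.2 _).trans (by rw [one_mul]; exact hM s.1 s.2 i j)

lemma continuous_norm_chaosSum :
    Continuous (fun p : (Fin n → ℝ) × (IdxSet n 2 → B) => ‖chaosSum p.2 p.1‖) := by
  unfold chaosSum
  fun_prop

lemma continuous_fSup {𝒯 : Set (IdxSet n 2 → B)} (h𝒯 : IsCompact 𝒯) : Continuous (fSup 𝒯) := by
  have := h𝒯.continuous_sSup (f := fun (x : Fin n → ℝ) s => ‖chaosSum s x‖)
    continuous_norm_chaosSum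
  simp only [sSup_image'] at this
  exact this

lemma norm_chaosSum_le_fSup {𝒯 : Set (IdxSet n 2 → B)} (h𝒯 : IsCompact 𝒯) (s : 𝒯)
    (x : Fin n → ℝ) : ‖chaosSum s.1 x‖ ≤ fSup 𝒯 x := by
  refine le_ciSup (f := fun s : 𝒯 => ‖chaosSum s.1 x‖) ?_ s
  have := (h𝒯.image (continuous_norm_chaosSum.comp (Continuous.prodMk_right x))).bddAbove
  refine this.mono ?_
  rintro _ ⟨s, rfl⟩
  exact ⟨s.1, s.2, rfl⟩

/-- The length of the gradient of `x ↦ v(∑_I x_I s_I)`. -/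
def chaosGrad (s : IdxSet n 2 → B) (v : B →L[ℝ] ℝ) (x : Fin n → ℝ) : ℝ :=
  Real.sqrt (∑ i, (∑ j, x j * v (tpair s i j)) ^ 2)

/-- The supremum of `chaosGrad` over `𝒯` and the dual unit ball. -/
def chaosGradSup (𝒯 : Set (IdxSet n 2 → B)) (x : Fin n → ℝ) : ℝ :=
  ⨆ s : 𝒯, ⨆ v : {v : B →L[ℝ] ℝ // ‖v‖ ≤ 1}, chaosGrad s.1 v.1 x

/-- The supremum of the operator norms of the coefficient matrices. -/
def chaosOpSup (𝒯 : Set (IdxSet n 2 → B)) : ℝ :=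
  ⨆ s : 𝒯, ⨆ v : {v : B →L[ℝ] ℝ // ‖v‖ ≤ 1}, mOp (fun i j => v.1 (tpair s.1 i j))

instance : Nonempty {v : B →L[ℝ] ℝ // ‖v‖ ≤ 1} := ⟨⟨0, by simp⟩⟩

variable {𝒯 : Set (IdxSet n 2 → B)}

lemma chaosGrad_le_add {M : ℝ} (hM : ∀ s ∈ 𝒯, ∀ i j, ‖tpair s i j‖ ≤ M) (s : 𝒯)
    (v : {v : B →L[ℝ] ℝ // ‖v‖ ≤ 1}) (x x' : Fin n → ℝ) :
    chaosGrad s.1 v.1 x ≤ chaosGrad s.1 v.1 x' + n * n * M * ‖x - x'‖ := by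
  refine (sqrt_sum_sq_le_add _ fun i => ∑ j, x' j * v.1 (tpair s.1 i j)).trans ?_
  refine add_le_add le_rfl ((sqrt_sum_sq_le_sum_abs _).trans ?_)
  calc ∑ i, |∑ j, x j * v.1 (tpair s.1 i j) - ∑ j, x' j * v.1 (tpair s.1 i j)|
      ≤ ∑ _i : Fin n, ∑ _j : Fin n, ‖x - x'‖ * M := by
        refine Finset.sum_le_sum fun i _ => ?_
        rw [← Finset.sum_sub_distrib]
        refine (Finset.abs_sum_le_sum_abs _ _).trans (Finset.sum_le_sum fun j _ => ?_)
        rw [← sub_mul, abs_mul]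
        exact mul_le_mul (norm_le_pi_norm (x - x') j) (abs_apply_tpair_le hM s v i j)
          (abs_nonneg _) (norm_nonneg _)
    _ = n * n * M * ‖x - x'‖ := by
        simp only [Finset.sum_const, Finset.card_univ, Fintype.card_fin, nsmul_eq_mul]
        ring

lemma chaosGrad_le_chaosGradSup (h𝒯 : IsCompact 𝒯) (s : 𝒯) (v : {v : B →L[ℝ] ℝ // ‖v‖ ≤ 1})
    (x : Fin n → ℝ) : chaosGrad s.1 v.1 x ≤ chaosGradSup 𝒯 x := by
  obtain ⟨M, -, hM⟩ := exists_norm_tpair_le h𝒯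
  refine le_ciSup_ciSup (h := fun (s : 𝒯) (v : {v : B →L[ℝ] ℝ // ‖v‖ ≤ 1}) =>
    chaosGrad s.1 v.1 x) (C := n * n * M * ‖x‖) (fun s v => ?_) s v
  simpa [chaosGrad] using chaosGrad_le_add hM s v x 0

lemma mOp_le_chaosOpSup (h𝒯 : IsCompact 𝒯) (s : 𝒯) (v : {v : B →L[ℝ] ℝ // ‖v‖ ≤ 1}) :
    mOp (fun i j => v.1 (tpair s.1 i j)) ≤ chaosOpSup 𝒯 := by
  obtain ⟨M, -, hM⟩ := exists_norm_tpair_le h𝒯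
  exact le_ciSup_ciSup (h := fun (s : 𝒯) (v : {v : B →L[ℝ] ℝ // ‖v‖ ≤ 1}) =>
    mOp (fun i j => v.1 (tpair s.1 i j))) (fun s v => mOp_le (abs_apply_tpair_le hM s v)) s v

lemma chaosGradSup_nonneg (x : Fin n → ℝ) : 0 ≤ chaosGradSup 𝒯 x :=
  Real.iSup_nonneg fun _ => Real.iSup_nonneg fun _ => Real.sqrt_nonneg _

lemma mOp_nonneg (A : Fin n → Fin n → ℝ) : 0 ≤ mOp A := by
  simpa using le_mOp A (w := 0) (u := 0) (by simp) (by simp)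

lemma chaosOpSup_nonneg : 0 ≤ chaosOpSup 𝒯 :=
  Real.iSup_nonneg fun _ => Real.iSup_nonneg fun _ => mOp_nonneg _

lemma continuous_chaosGradSup (h𝒯 : IsCompact 𝒯) (hne : 𝒯.Nonempty) :
    Continuous (chaosGradSup 𝒯) := by
  have := hne.to_subtype
  obtain ⟨M, hM0, hM⟩ := exists_norm_tpair_le h𝒯
  refine (LipschitzWith.of_le_add_mul (Real.toNNReal (n * n * M)) fun x x' => ?_).continuous
  rw [Real.coe_toNNReal _ (by positivity), dist_eq_norm]
  exact ciSup_le fun s => ciSup_le fun v => (chaosGrad_le_add hM s v x x').trans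
    (add_le_add (chaosGrad_le_chaosGradSup h𝒯 s v x') le_rfl)

variable {a b : ℝ}

lemma abs_sub_le_of_mem_Icc {x y : ℝ} (hx : x ∈ Set.Icc a b) (hy : y ∈ Set.Icc a b) :
    |x - y| ≤ b - a := by
  rw [abs_le]
  constructor <;> linarith [hx.1, hx.2, hy.1, hy.2]

lemma gradSqLe_fSup (h𝒯 : IsCompact 𝒯) (hne : 𝒯.Nonempty) (hab : a ≤ b) :
    GradSqLe a b (fSup 𝒯) (fun x => (b - a) ^ 2 * chaosGradSup 𝒯 x ^ 2) := by
  have := hne.to_subtype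
  refine gradSqLe_of_forall_pos (continuous_fSup h𝒯) fun x hx ε hε => ?_
  obtain ⟨s, hs⟩ := exists_lt_of_lt_ciSup
    (show fSup 𝒯 x - ε < ⨆ s : 𝒯, ‖chaosSum s.1 x‖ from sub_lt_self _ hε)
  obtain ⟨v, hv1, hv⟩ := exists_dual_vector'' ℝ (chaosSum s.1 x)
  refine ⟨fun i => (b - a) * |∑ j, x j * v (tpair s.1 i j)|,
    fun i => mul_nonneg (sub_nonneg.2 hab) (abs_nonneg _), fun i y hy => ?_, ?_⟩
  · have h1 : v (chaosSum s.1 (Function.update x i y)) ≤ fSup 𝒯 (Function.update x i y) :=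
      ((le_abs_self _).trans ((v.le_of_opNorm_le hv1 _).trans_eq (one_mul _))).trans
        (norm_chaosSum_le_fSup h𝒯 s _)
    have h2 : v (chaosSum s.1 x) - v (chaosSum s.1 (Function.update x i y)) =
        (x i - y) * ∑ j, x j * v (tpair s.1 i j) := by
      rw [← map_sub, chaosSum_sub_update]
      simp
    have h3 : (x i - y) * ∑ j, x j * v (tpair s.1 i j) ≤
        (b - a) * |∑ j, x j * v (tpair s.1 i j)| := by
      refine (le_abs_self _).trans ?_
      rw [abs_mul]
      have := abs_sub_le_of_mem_Icc (hx i) hy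
      gcongr
    simp only [RCLike.ofReal_real_eq_id, id_eq] at hv
    linarith
  · simp only [mul_pow, sq_abs]
    rw [← Finset.mul_sum]
    refine mul_le_mul_of_nonneg_left ?_ (sq_nonneg _)
    rw [← Real.sqrt_le_left (chaosGradSup_nonneg x)]
    exact chaosGrad_le_chaosGradSup h𝒯 s ⟨v, hv1⟩ x

lemma gradSqLe_chaosGradSup (h𝒯 : IsCompact 𝒯) (hne : 𝒯.Nonempty) (hab : a ≤ b) :
    GradSqLe a b (chaosGradSup 𝒯) (fun _ => (b - a) ^ 2 * chaosOpSup 𝒯 ^ 2) := by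
  have := hne.to_subtype
  refine gradSqLe_of_forall_pos (continuous_chaosGradSup h𝒯 hne) fun x hx ε hε => ?_
  obtain ⟨s, v, hs⟩ := exists_lt_of_lt_ciSup_ciSup
    (h := fun (s : 𝒯) (v : {v : B →L[ℝ] ℝ // ‖v‖ ≤ 1}) => chaosGrad s.1 v.1 x)
    (show chaosGradSup 𝒯 x - ε < _ from sub_lt_self _ hε)
  obtain ⟨w, hw1, hw⟩ := exists_sum_mul_eq_sqrt_sum_sq
    fun i => ∑ j, x j * v.1 (tpair s.1 i j)
  refine ⟨fun j => (b - a) * |∑ i, w i * v.1 (tpair s.1 i j)|,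
    fun i => mul_nonneg (sub_nonneg.2 hab) (abs_nonneg _), fun k y hy => ?_, ?_⟩
  · have h1 := (sum_mul_le_sqrt_sum_sq hw1 fun i => ∑ j, Function.update x k y j *
      v.1 (tpair s.1 i j)).trans (chaosGrad_le_chaosGradSup h𝒯 s v (Function.update x k y))
    have h2 : ∑ i, w i * (∑ j, x j * v.1 (tpair s.1 i j)) -
        ∑ i, w i * (∑ j, Function.update x k y j * v.1 (tpair s.1 i j)) =
        (x k - y) * ∑ i, w i * v.1 (tpair s.1 i k) := by
      rw [← Finset.sum_sub_distrib, Finset.mul_sum]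
      refine Finset.sum_congr rfl fun i _ => ?_
      rw [← mul_sub, ← Finset.sum_sub_distrib, Finset.sum_eq_single k]
      · rw [Function.update_self]
        ring
      · intro j _ hj
        rw [Function.update_of_ne hj, sub_self]
      · simp
    have h3 : (x k - y) * ∑ i, w i * v.1 (tpair s.1 i k) ≤
        (b - a) * |∑ i, w i * v.1 (tpair s.1 i k)| := by
      refine (le_abs_self _).trans ?_
      rw [abs_mul]
      have := abs_sub_le_of_mem_Icc (hx k) hy
      gcongr
    simp only [chaosGrad, ← hw] at hs
    linarith
  · simp only [mul_pow, sq_abs]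
    rw [← Finset.mul_sum]
    refine mul_le_mul_of_nonneg_left ?_ (sq_nonneg _)
    rw [← Real.sqrt_le_left chaosOpSup_nonneg]
    exact (sqrt_sum_sq_mul_le_mOp _ hw1).trans (mOp_le_chaosOpSup h𝒯 s v)

end Chaos

section Clamp

variable {n : ℕ} {a b : ℝ} {F W : (Fin n → ℝ) → ℝ}

/-- Coordinatewise projection onto the cube `[a, b]^n`. -/
def clamp (a b : ℝ) (x : Fin n → ℝ) : Fin n → ℝ := fun i => max a (min b (x i))

lemma clamp_mem (hab : a ≤ b) (x : Fin n → ℝ) (i : Fin n) : clamp a b x i ∈ Set.Icc a b :=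
  ⟨le_max_left _ _, max_le hab (min_le_left _ _)⟩

lemma clamp_eq_self {x : Fin n → ℝ} (hx : ∀ i, x i ∈ Set.Icc a b) : clamp a b x = x := by
  funext i
  simp [clamp, (hx i).1, (hx i).2]

lemma continuous_clamp : Continuous (clamp a b : (Fin n → ℝ) → Fin n → ℝ) := by
  unfold clamp
  fun_prop

lemma bddMeas_comp_clamp (hab : a ≤ b) (hF : Continuous F) :
    BddMeas (fun x => F (clamp a b x)) := by
  refine ⟨(hF.comp continuous_clamp).measurable, ?_⟩
  have hK : IsCompact (Set.pi Set.univ fun _ : Fin n => Set.Icc a b) :=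
    isCompact_univ_pi fun _ => isCompact_Icc
  obtain ⟨M, hM⟩ := hK.exists_bound_of_continuousOn hF.continuousOn
  exact ⟨M, fun x => hM _ fun i _ => clamp_mem hab x i⟩

lemma GradSqLe.comp_clamp (h : GradSqLe a b F W) :
    GradSqLe a b (fun x => F (clamp a b x)) (fun x => W (clamp a b x)) := by
  intro x hx
  obtain ⟨c, hc0, hc, hcW⟩ := h x hx
  refine ⟨c, hc0, fun i y hy => ?_, by simpa only [clamp_eq_self hx] using hcW⟩
  have hx' : ∀ j, Function.update x i y j ∈ Set.Icc a b := fun j => by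
    rcases eq_or_ne j i with rfl | hj
    · simpa using hy
    · simpa [hj] using hx j
  simpa only [clamp_eq_self hx, clamp_eq_self hx'] using hc i y hy

end Clamp

/-- deviation inequality for suprema of second order chaos in a Banach space
(Corollary `corollary:ChaosInBanachSpaces`). -/
theorem stmt6 {n : ℕ} {B : Type*} [NormedAddCommGroup B] [NormedSpace ℝ B]
    (𝒯 : Set (IdxSet n 2 → B)) (h𝒯c : IsCompact 𝒯) (h𝒯ne : 𝒯.Nonempty)
    (a b : ℝ) (hab : a < b)
    (μ : Measure (Fin n → ℝ)) (hμ : IsProbabilityMeasure μ)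
    (hsupp : ∀ᵐ x ∂μ, ∀ i, x i ∈ Set.Icc a b)
    (ν : ∀ i : Fin n, (Fin n → ℝ) → Measure ℝ) (σ2 : ℝ) (hσ : 0 < σ2)
    (hLSI : DLSI μ ν σ2) (t : ℝ) (ht : 0 ≤ t) :
    μ {x | t ≤ fSup 𝒯 x - ∫ y, fSup 𝒯 y ∂μ} ≤
      ENNReal.ofReal (2 * Real.exp (-(1 / (60 * (b - a) ^ 2 * σ2)) * min
        (t ^ 2 /
          (∫ x, (⨆ s : 𝒯, ⨆ v : {v : B →L[ℝ] ℝ // ‖v‖ ≤ 1},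
            Real.sqrt (∑ i, (∑ j, x j * v.1 (tpair s.1 i j)) ^ 2)) ∂μ) ^ 2)
        (t / ⨆ s : 𝒯, ⨆ v : {v : B →L[ℝ] ℝ // ‖v‖ ≤ 1},
          mOp (fun i j => v.1 (tpair s.1 i j))))) := by
  change _ ≤ ENNReal.ofReal (2 * Real.exp (-(1 / (60 * (b - a) ^ 2 * σ2)) * min
    (t ^ 2 / (∫ x, chaosGradSup 𝒯 x ∂μ) ^ 2) (t / chaosOpSup 𝒯)))
  have hδ : 0 < (b - a) ^ 2 := pow_pos (sub_pos.2 hab) 2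
  have hτ : 0 ≤ chaosOpSup 𝒯 := chaosOpSup_nonneg
  have hclamp : ∀ᵐ x ∂μ, clamp a b x = x := hsupp.mono fun x hx => clamp_eq_self hx
  have hf : ∫ x, fSup 𝒯 (clamp a b x) ∂μ = ∫ x, fSup 𝒯 x ∂μ :=
    integral_congr_ae (hclamp.mono fun x hx => congrArg (fSup 𝒯) hx)
  have hg : ∫ x, chaosGradSup 𝒯 (clamp a b x) ∂μ = ∫ x, chaosGradSup 𝒯 x ∂μ :=
    integral_congr_ae (hclamp.mono fun x hx => congrArg (chaosGradSup 𝒯) hx)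
  have key := measureReal_ge_le_of_gradSqLe hσ hLSI hsupp
    ((continuous_fSup h𝒯c).comp continuous_clamp)
    (bddMeas_comp_clamp hab.le (continuous_fSup h𝒯c))
    ((continuous_chaosGradSup h𝒯c h𝒯ne).comp continuous_clamp)
    (bddMeas_comp_clamp hab.le (continuous_chaosGradSup h𝒯c h𝒯ne))
    (fun x => chaosGradSup_nonneg _) hδ hτ
    (gradSqLe_fSup h𝒯c h𝒯ne hab.le).comp_clamp
    (gradSqLe_chaosGradSup h𝒯c h𝒯ne hab.le).comp_clamp ht
  simp only [Function.comp_apply] at key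
  rw [hf, hg] at key
  have hset : μ {x | t ≤ fSup 𝒯 x - ∫ y, fSup 𝒯 y ∂μ} =
      μ {x | t ≤ fSup 𝒯 (clamp a b x) - ∫ y, fSup 𝒯 y ∂μ} := by
    refine measure_congr (hclamp.mono fun x hx => ?_)
    change (t ≤ _) = (t ≤ fSup 𝒯 (clamp a b x) - _)
    rw [hx]
  rw [hset, ← ofReal_measureReal]
  refine ENNReal.ofReal_le_ofReal (key.trans ?_)
  have hm : 0 ≤ min (t ^ 2 / (∫ x, chaosGradSup 𝒯 x ∂μ) ^ 2) (t / chaosOpSup 𝒯) :=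
    le_min (by positivity) (by positivity)
  gcongr
  norm_num

end
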